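/- For all positive integers n, d and every integer k ≥ 2, A(n,d) ≤ A_k(n,d); that is, for every code C ⊆ {0,1}^n of minimum distance at least d, the cardinality |C| is at most the supremum defining A_k(n,d). (In particular, the function x with x(S) = 1 if S ⊆ C and x(S) = 0 otherwise is feasible: x(∅) = 1 and every matrix M_S(x) is positive semidefinite, and its objective value is |C|.) -/

import Mathlib

open scoped Classical

noncomputable section

/-- `S` is a code of minimum distance at least `d`: any two distinct words of `S`
have Hamming distance at least `d`. -/
def IsCode (n d : ℕ) (S : Finset (Fin n → Bool)) : Prop :=
  ∀ u ∈ S, ∀ v ∈ S, u ≠ v → d ≤ hammingDist u v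

/-- The collection `𝒩_k` of codes of minimum distance at least `d` and size at most `k`. -/
def NNk (n d k : ℕ) : Set (Finset (Fin n → Bool)) :=
  {S | IsCode n d S ∧ S.card ≤ k}

/-- The index set `𝒩(S)` of the matrix `M_S(x)`:
codes `S' ⊇ S` of minimum distance at least `d` with `|S| + 2|S'∖S| ≤ k`. -/
abbrev NSet (n d k : ℕ) (S : Finset (Fin n → Bool)) :=
  {S' : Finset (Fin n → Bool) //
    IsCode n d S' ∧ S ⊆ S' ∧ S.card + 2 * (S' \ S).card ≤ k}

/-- The matrix `M_S(x)`, with `(S',S'')` entry `x(S' ∪ S'')` if `S' ∪ S''` is a code of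
minimum distance at least `d`, and `0` otherwise. -/
def MS (n d k : ℕ) (S : Finset (Fin n → Bool)) (x : Finset (Fin n → Bool) → ℝ) :
    Matrix (NSet n d k S) (NSet n d k S) ℝ :=
  fun S' S'' => if IsCode n d (S'.1 ∪ S''.1) then x (S'.1 ∪ S''.1) else 0

/-- Feasibility for the semidefinite program defining `A_k(n,d)`:
`x(∅) = 1` and `M_S(x)` is positive semidefinite for every `S ∈ 𝒩_k`. -/
def Feasible (n d k : ℕ) (x : Finset (Fin n → Bool) → ℝ) : Prop :=
  x ∅ = 1 ∧ ∀ S ∈ NNk n d k, (MS n d k S x).PosSemidef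

/-- The objective value `∑_{v ∈ N} x({v})`. -/
def Obj (n : ℕ) (x : Finset (Fin n → Bool) → ℝ) : ℝ :=
  ∑ v : Fin n → Bool, x {v}

/-- The semidefinite programming bound `A_k(n,d)`. -/
def Abound (n d k : ℕ) : ℝ :=
  sSup {y : ℝ | ∃ x : Finset (Fin n → Bool) → ℝ, Feasible n d k x ∧ y = Obj n x}

/-- The incidence function `S ↦ [S ⊆ C]` of a code `C` is feasible. -/
theorem feasible_indicator_subset {n d : ℕ} (k : ℕ) {C : Finset (Fin n → Bool)}
    (hC : IsCode n d C) : Feasible n d k (fun S => if S ⊆ C then 1 else 0) := by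
  refine ⟨by simp, fun S _ => ?_⟩
  convert Matrix.posSemidef_vecMulVec_self_star
    (fun S' : NSet n d k S => if S'.1 ⊆ C then (1 : ℝ) else 0) using 1
  ext S' S''
  have hcode : S'.1 ∪ S''.1 ⊆ C → IsCode n d (S'.1 ∪ S''.1) :=
    fun h u hu v hv => hC u (h hu) v (h hv)
  simp only [MS, Matrix.vecMulVec_apply, star_trivial]
  rw [Finset.union_subset_iff] at hcode
  simp only [Finset.union_subset_iff]
  split_ifs <;> simp_all

/-- The objective value of the incidence function of `C` is the cardinality of `C`. -/
theorem obj_indicator_subset {n : ℕ} (C : Finset (Fin n → Bool)) :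
    Obj n (fun S => if S ⊆ C then 1 else 0) = C.card := by
  simp [Obj]

/-- Feasible functions take values at most one on singletons. -/
theorem Feasible.singleton_le_one {n d k : ℕ} (hk : 2 ≤ k) {x : Finset (Fin n → Bool) → ℝ}
    (hx : Feasible n d k x) (v : Fin n → Bool) : x {v} ≤ 1 := by
  have hempty : IsCode n d ∅ := by simp [IsCode]
  have hsingle : IsCode n d {v} := by simp [IsCode]
  let e : Fin 2 → NSet n d k ∅ :=
    ![⟨∅, hempty, by simp, by simp⟩, ⟨{v}, hsingle, by simp, by simpa using hk⟩]
  have hdet := ((hx.2 ∅ ⟨hempty, by simp⟩).submatrix e).det_nonneg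
  simp [Matrix.det_fin_two, MS, e, hempty, hsingle, hx.1] at hdet
  nlinarith

/-- The objective values of feasible functions are bounded above. -/
theorem bddAbove_obj_feasible {n d k : ℕ} (hk : 2 ≤ k) :
    BddAbove {y : ℝ | ∃ x : Finset (Fin n → Bool) → ℝ, Feasible n d k x ∧ y = Obj n x} := by
  refine ⟨∑ _v : Fin n → Bool, 1, ?_⟩
  rintro _ ⟨x, hx, rfl⟩
  exact Finset.sum_le_sum fun v _ => hx.singleton_le_one hk v

/-- `A(n,d) ≤ A_k(n,d)`: the cardinality of any code `C ⊆ {0,1}^n` of minimum distance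
at least `d` is at most the semidefinite programming bound `A_k(n,d)`. -/
theorem A_le_Abound (n d k : ℕ) (hn : 0 < n) (hd : 0 < d) (hk : 2 ≤ k)
    (C : Finset (Fin n → Bool)) (hC : IsCode n d C) :
    (C.card : ℝ) ≤ Abound n d k :=
  le_csSup (bddAbove_obj_feasible hk)
    ⟨_, feasible_indicator_subset k hC, (obj_indicator_subset C).symm⟩
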